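/- arXiv:2511.03473 — 3 statements merged into one kernel-verified Lean document; each statement's English description precedes it below -/
import Mathlib

section
/- Let (S, A, H, P, r) be a G-invariant finite-horizon MDP and let π be an equivariant stochastic policy. Then for every step h ∈ {1, …, H+1}, every g ∈ G, every s ∈ S, and every a ∈ A, the value functions of π are invariant: Q^π_h(g•s, g•a) = Q^π_h(s, a) and V^π_h(g•s) = V^π_h(s). -/
/-- If `p'` and `f'` are the translates of `p` and `f` by `g`, then the sums of `p * f` and
`p' * f'` over the space acted upon agree. -/
theorem sum_mul_eq_of_smul {G X R : Type*} [Group G] [MulAction G X] [Fintype X]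
    [NonUnitalNonAssocSemiring R] {g : G} {p p' f f' : X → R}
    (hp : ∀ x, p' (g • x) = p x) (hf : ∀ x, f' (g • x) = f x) :
    ∑ x, p' x * f' x = ∑ x, p x * f x := by
  rw [← Equiv.sum_comp (MulAction.toPerm g)]
  simp only [MulAction.toPerm_apply, hp, hf]


/-- In a `G`-invariant finite-horizon MDP, an equivariant stochastic
policy has invariant value functions: `Qᵖⁱ_h (g•s) (g•a) = Qᵖⁱ_h s a` and
`Vᵖⁱ_h (g•s) = Vᵖⁱ_h s` for all steps `h`. -/
theorem invariant_value_functions_of_equivariant_policy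
    {S A G : Type*} [Fintype S] [Nonempty S] [Fintype A] [Nonempty A]
    [Group G] [Fintype G] [MulAction G S] [MulAction G A]
    (H : ℕ)
    (P : S → A → S → ℝ) (r : S → A → ℝ)
    (hP_nonneg : ∀ s a s', 0 ≤ P s a s')
    (hP_sum : ∀ s a, ∑ s' : S, P s a s' = 1)
    (hP_inv : ∀ (g : G) (s : S) (a : A) (s' : S),
      P (g • s) (g • a) (g • s') = P s a s')
    (hr_inv : ∀ (g : G) (s : S) (a : A), r (g • s) (g • a) = r s a)
    (π : ℕ → S → A → ℝ)
    (hπ_nonneg : ∀ h s a, 0 ≤ π h s a)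
    (hπ_sum : ∀ h s, ∑ a : A, π h s a = 1)
    (hπ_equiv : ∀ (g : G) (h : ℕ) (s : S) (a : A),
      π h (g • s) (g • a) = π h s a)
    (Q : ℕ → S → A → ℝ) (V : ℕ → S → ℝ)
    (hV_top : ∀ s, V (H + 1) s = 0)
    (hQ : ∀ h ∈ Finset.Icc 1 H, ∀ (s : S) (a : A),
      Q h s a = r s a + ∑ s' : S, P s a s' * V (h + 1) s')
    (hV : ∀ h ∈ Finset.Icc 1 H, ∀ s : S,
      V h s = ∑ a : A, π h s a * Q h s a) :
    (∀ h ∈ Finset.Icc 1 H, ∀ (g : G) (s : S) (a : A),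
      Q h (g • s) (g • a) = Q h s a) ∧
    (∀ h ∈ Finset.Icc 1 (H + 1), ∀ (g : G) (s : S),
      V h (g • s) = V h s) := by
  have Q_step : ∀ h ∈ Finset.Icc 1 H, (∀ (g : G) (s : S), V (h + 1) (g • s) = V (h + 1) s) →
      ∀ (g : G) (s : S) (a : A), Q h (g • s) (g • a) = Q h s a := by
    intro h hh ih g s a
    rw [hQ h hh, hQ h hh, hr_inv, sum_mul_eq_of_smul (hP_inv g s a) (ih g)]
  have V_inv : ∀ h ∈ Finset.Icc 1 (H + 1), ∀ (g : G) (s : S), V h (g • s) = V h s := by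
    intro h hh
    obtain ⟨h_one, h_top⟩ := Finset.mem_Icc.mp hh
    clear hh
    induction h_top using Nat.decreasingInduction with
    | self => simp [hV_top]
    | of_succ k hk ih =>
      intro g s
      have hk' : k ∈ Finset.Icc 1 H := Finset.mem_Icc.mpr ⟨by omega, by omega⟩
      rw [hV k hk', hV k hk']
      exact sum_mul_eq_of_smul (hπ_equiv g k s)
        (Q_step k hk' (ih (by omega)) g s)
  refine ⟨fun h hh => Q_step h hh (V_inv (h + 1) ?_), V_inv⟩
  simp only [Finset.mem_Icc] at hh ⊢
  omega
end

section
/- Let (S, A, H, P, r) be a G-invariant finite-horizon MDP. Define the optimal value functions by backward recursion: V*_{H+1} ≡ 0, Q*_h(s,a) = r(s,a) + ∑_{s'∈S} P(s'|s,a) · V*_{h+1}(s'), and V*_h(s) = max_{a∈A} Q*_h(s,a). Then for every h ∈ {1, …, H+1}, g ∈ G, s ∈ S, a ∈ A: Q*_h(g•s, g•a) = Q*_h(s, a) and V*_h(g•s) = V*_h(s). -/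
/-- One Bellman backup of a `G`-invariant state-value function is invariant under the diagonal
action on state-action pairs. -/
theorem bellman_backup_smul {S A G : Type*} [Fintype S] [Group G] [MulAction G S] [SMul G A]
    {P : S → A → S → ℝ} {r : S → A → ℝ} {v : S → ℝ}
    (hP : ∀ (g : G) (s : S) (a : A) (s' : S), P (g • s) (g • a) (g • s') = P s a s')
    (hr : ∀ (g : G) (s : S) (a : A), r (g • s) (g • a) = r s a)
    (hv : ∀ (g : G) (s : S), v (g • s) = v s) (g : G) (s : S) (a : A) :
    r (g • s) (g • a) + ∑ s' : S, P (g • s) (g • a) s' * v s' =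
      r s a + ∑ s' : S, P s a s' * v s' := by
  rw [hr, ← Equiv.sum_comp (MulAction.toPerm g)]
  simp only [MulAction.toPerm_apply, hP, hv]

/-- Maximizing a `G`-invariant state-action function over actions gives a `G`-invariant
function. -/
theorem sup'_univ_smul {S A G : Type*} [Fintype A] [Nonempty A] [Group G] [SMul G S]
    [MulAction G A] {q : S → A → ℝ}
    (hq : ∀ (g : G) (s : S) (a : A), q (g • s) (g • a) = q s a) (g : G) (s : S) :
    (Finset.univ.sup' Finset.univ_nonempty fun a : A => q (g • s) a) =
      Finset.univ.sup' Finset.univ_nonempty fun a : A => q s a := by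
  apply le_antisymm
  · refine Finset.sup'_le _ _ fun a _ => ?_
    rw [← smul_inv_smul g a, hq]
    exact Finset.le_sup' (fun a : A => q s a) (Finset.mem_univ (g⁻¹ • a))
  · refine Finset.sup'_le _ _ fun a _ => ?_
    rw [← hq g s a]
    exact Finset.le_sup' (fun a : A => q (g • s) a) (Finset.mem_univ (g • a))

/-- In a `G`-invariant finite-horizon MDP, the optimal value
functions (defined by backward recursion with a max over actions) are invariant:
`Q*_h (g•s) (g•a) = Q*_h s a` and `V*_h (g•s) = V*_h s`. -/
theorem optimal_value_functions_invariant
    {S A G : Type*} [Fintype S] [Nonempty S] [Fintype A] [Nonempty A]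
    [Group G] [Fintype G] [MulAction G S] [MulAction G A]
    (H : ℕ)
    (P : S → A → S → ℝ) (r : S → A → ℝ)
    (hP_nonneg : ∀ s a s', 0 ≤ P s a s')
    (hP_sum : ∀ s a, ∑ s' : S, P s a s' = 1)
    (hP_inv : ∀ (g : G) (s : S) (a : A) (s' : S),
      P (g • s) (g • a) (g • s') = P s a s')
    (hr_inv : ∀ (g : G) (s : S) (a : A), r (g • s) (g • a) = r s a)
    (Q : ℕ → S → A → ℝ) (V : ℕ → S → ℝ)
    (hV_top : ∀ s, V (H + 1) s = 0)
    (hQ : ∀ h ∈ Finset.Icc 1 H, ∀ (s : S) (a : A),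
      Q h s a = r s a + ∑ s' : S, P s a s' * V (h + 1) s')
    (hV : ∀ h ∈ Finset.Icc 1 H, ∀ s : S,
      V h s = Finset.univ.sup' Finset.univ_nonempty fun a : A => Q h s a) :
    (∀ h ∈ Finset.Icc 1 H, ∀ (g : G) (s : S) (a : A),
      Q h (g • s) (g • a) = Q h s a) ∧
    (∀ h ∈ Finset.Icc 1 (H + 1), ∀ (g : G) (s : S),
      V h (g • s) = V h s) := by
  have hQ_inv : ∀ h ∈ Finset.Icc 1 H, (∀ (g : G) (s : S), V (h + 1) (g • s) = V (h + 1) s) →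
      ∀ (g : G) (s : S) (a : A), Q h (g • s) (g • a) = Q h s a := by
    intro h hh hv g s a
    rw [hQ h hh, hQ h hh]
    exact bellman_backup_smul hP_inv hr_inv hv g s a
  have hV_inv : ∀ h ∈ Finset.Icc 1 (H + 1), ∀ (g : G) (s : S), V h (g • s) = V h s := by
    intro h hh
    obtain ⟨h_pos, h_le⟩ := Finset.mem_Icc.mp hh
    clear hh
    induction h_le using Nat.decreasingInduction with
    | self => simp [hV_top]
    | of_succ k hk ih =>
      have hkH : k ∈ Finset.Icc 1 H := Finset.mem_Icc.mpr ⟨h_pos, Nat.lt_succ_iff.mp hk⟩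
      intro g s
      rw [hV k hkH, hV k hkH]
      exact sup'_univ_smul (hQ_inv k hkH (ih k.succ_pos)) g s
  refine ⟨fun h hh => hQ_inv h hh (hV_inv (h + 1) ?_), hV_inv⟩
  rw [Finset.mem_Icc] at hh ⊢
  omega
end

section
/- Let (S, A, H, P, r) be a G-invariant finite-horizon MDP in which the action of G on A is trivial (g•a = a). Define the quotient MDP on the orbit space S/G with transition kernel P̄(Orb(s') | Orb(s), a) := ∑_{s''∈Orb(s')} P(s'' | s, a) and reward r̄(Orb(s), a) := r(s, a) (both well-defined by G-invariance), and let V̄*_h denote its optimal value functions, defined by backward recursion V̄*_{H+1} ≡ 0, V̄*_h(ō) = max_a [ r̄(ō, a) + ∑_{ō'∈S/G} P̄(ō'|ō,a) · V̄*_{h+1}(ō') ]. Then for every h ∈ {1, …, H+1} and every s ∈ S, V̄*_h(Orb(s)) = V*_h(s), where V*_h are the optimal value functions of the original MDP (V*_{H+1} ≡ 0, V*_h(s) = max_a [ r(s,a) + ∑_{s'} P(s'|s,a) V*_{h+1}(s') ]). -/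
/-- The fibre of the orbit projection over the orbit of `s` is the image of the orbit map. -/
theorem filter_orbit_mk_eq_image {S G : Type*} [Fintype S] [DecidableEq S]
    [Group G] [Fintype G] [MulAction G S]
    [DecidableEq (Quotient (MulAction.orbitRel G S))] (s : S) :
    Finset.univ.filter (fun t : S => Quotient.mk (MulAction.orbitRel G S) t =
        Quotient.mk (MulAction.orbitRel G S) s) =
      Finset.univ.image (fun g : G => g • s) := by
  ext t
  simp only [Finset.mem_filter, Finset.mem_univ, true_and, Finset.mem_image]
  rw [Quotient.eq, MulAction.orbitRel_apply]
  rfl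

/-- Integrating a function on the orbit space against the pushforward of the weights `p` is the
same as integrating its pullback against `p`. -/
theorem sum_orbit_mul_eq_sum {S G : Type*} [Fintype S] [DecidableEq S]
    [Group G] [Fintype G] [MulAction G S]
    [Fintype (Quotient (MulAction.orbitRel G S))]
    (p : S → ℝ) (q V : Quotient (MulAction.orbitRel G S) → ℝ)
    (hq : ∀ s, q (Quotient.mk (MulAction.orbitRel G S) s) =
      ∑ t ∈ Finset.univ.image (fun g : G => g • s), p t) :
    ∑ o, q o * V o = ∑ s, p s * V (Quotient.mk (MulAction.orbitRel G S) s) := by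
  classical
  rw [← Finset.sum_fiberwise Finset.univ (Quotient.mk (MulAction.orbitRel G S))]
  refine Finset.sum_congr rfl fun o _ => ?_
  induction o using Quotient.inductionOn with
  | h s =>
    rw [hq, ← filter_orbit_mk_eq_image, Finset.sum_mul]
    refine Finset.sum_congr rfl fun t ht => ?_
    rw [(Finset.mem_filter.mp ht).2]


open scoped Classical in
/-- For a `G`-invariant finite-horizon MDP with trivial action on `A`,
the quotient MDP on the orbit space `S/G` (with transition kernel
`P̄(Orb s' | Orb s, a) = ∑_{s'' ∈ Orb s'} P(s'' | s, a)` and reward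
`r̄(Orb s, a) = r(s, a)`) has optimal value functions satisfying
`V̄*_h (Orb s) = V*_h s` for every step `h` and every state `s`. -/
theorem quotient_MDP_optimal_values
    {S A G : Type*} [Fintype S] [DecidableEq S] [Nonempty S]
    [Fintype A] [Nonempty A]
    [Group G] [Fintype G] [MulAction G S] [MulAction G A]
    (H : ℕ)
    (P : S → A → S → ℝ) (r : S → A → ℝ)
    (hP_nonneg : ∀ s a s', 0 ≤ P s a s')
    (hP_sum : ∀ s a, ∑ s' : S, P s a s' = 1)
    (hP_inv : ∀ (g : G) (s : S) (a : A) (s' : S),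
      P (g • s) (g • a) (g • s') = P s a s')
    (hr_inv : ∀ (g : G) (s : S) (a : A), r (g • s) (g • a) = r s a)
    (hA_trivial : ∀ (g : G) (a : A), g • a = a)
    (Pbar : Quotient (MulAction.orbitRel G S) → A →
      Quotient (MulAction.orbitRel G S) → ℝ)
    (rbar : Quotient (MulAction.orbitRel G S) → A → ℝ)
    (hPbar : ∀ (s s' : S) (a : A),
      Pbar (Quotient.mk (MulAction.orbitRel G S) s) a
          (Quotient.mk (MulAction.orbitRel G S) s') =
        ∑ s'' ∈ Finset.univ.image (fun g : G => g • s'), P s a s'')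
    (hrbar : ∀ (s : S) (a : A),
      rbar (Quotient.mk (MulAction.orbitRel G S) s) a = r s a)
    (Vbar : ℕ → Quotient (MulAction.orbitRel G S) → ℝ)
    (Vstar : ℕ → S → ℝ)
    (hVbar_top : ∀ o, Vbar (H + 1) o = 0)
    (hVbar : ∀ h ∈ Finset.Icc 1 H, ∀ o,
      Vbar h o = Finset.univ.sup' Finset.univ_nonempty fun a : A =>
        rbar o a +
          ∑ o' : Quotient (MulAction.orbitRel G S), Pbar o a o' * Vbar (h + 1) o')
    (hVstar_top : ∀ s, Vstar (H + 1) s = 0)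
    (hVstar : ∀ h ∈ Finset.Icc 1 H, ∀ s : S,
      Vstar h s = Finset.univ.sup' Finset.univ_nonempty fun a : A =>
        r s a + ∑ s' : S, P s a s' * Vstar (h + 1) s') :
    ∀ h ∈ Finset.Icc 1 (H + 1), ∀ s : S,
      Vbar h (Quotient.mk (MulAction.orbitRel G S) s) = Vstar h s := by
  intro h hh
  obtain ⟨h_pos, h_le⟩ := Finset.mem_Icc.mp hh
  clear hh
  induction h_le using Nat.decreasingInduction with
  | self => intro s; rw [hVbar_top, hVstar_top]
  | of_succ k hk ih =>
    intro s
    have hmem : k ∈ Finset.Icc 1 H := Finset.mem_Icc.mpr ⟨h_pos, Nat.le_of_lt_succ hk⟩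
    rw [hVbar k hmem, hVstar k hmem]
    refine Finset.sup'_congr _ rfl fun a _ => ?_
    rw [hrbar, sum_orbit_mul_eq_sum (P s a) _ _ fun s' => hPbar s s' a]
    simp only [ih (Nat.succ_pos k)]
end
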